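/- arXiv:2111.05281 — 12 statements merged into one kernel-verified Lean document; each statement's English description precedes it below -/
import Mathlib

section
/- Let r ≥ 4, let k be a natural number and set p = 2^k. Let X_0, …, X_{p−1} be r-robust schedules, and suppose the real number ρ is an upper bound on the acceleration ratio of the p-processor schedule defined by X_0, …, X_{p−1}. Then ρ ≥ inf { x^{p+1}/(x^p − 1) : ζ_{1,r}^{1/p} ≤ x ≤ ζ_{2,r}^{1/p} }. -/
open Filter Finset

/-- A schedule: a strictly increasing sequence of positive reals. -/
def IsSchedule (X : ℕ → ℝ) : Prop := StrictMono X ∧ ∀ i, 0 < X i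

/-- `ℓ(X,T)`: the largest contract length of `X` completed by time `T`. -/
noncomputable def ell (X : ℕ → ℝ) (T : ℝ) : ℝ :=
  sSup {y : ℝ | ∃ i : ℕ, y = X i ∧ ∑ j ∈ Finset.range (i + 1), X j ≤ T}

/-- An `r`-robust schedule. -/
def IsRobust (r : ℝ) (X : ℕ → ℝ) : Prop :=
  X 0 ≤ r ∧ ∀ n : ℕ, 1 ≤ n → ∑ j ∈ Finset.range (n + 1), X j ≤ r * X (n - 1)

/-- The smaller root of `x² - r·x + r = 0`. -/
noncomputable def zeta1 (r : ℝ) : ℝ := (r - Real.sqrt (r ^ 2 - 4 * r)) / 2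

/-- The larger root of `x² - r·x + r = 0`. -/
noncomputable def zeta2 (r : ℝ) : ℝ := (r + Real.sqrt (r ^ 2 - 4 * r)) / 2

lemma no_descent (u : ℕ → ℝ) (c : ℝ) (hc : 0 < c) (hu : ∀ n, 0 ≤ u n)
    (h : ∀ n, u (n + 1) ≤ u n - c) : False := by
  have h1 : ∀ n : ℕ, u n ≤ u 0 - n * c := by
    intro n
    induction n with
    | zero => simp
    | succ n ih => push_cast; linarith [h n]
  obtain ⟨n, hn⟩ := exists_nat_gt (u 0 / c)
  rw [div_lt_iff₀ hc] at hn
  linarith [h1 n, hu n]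

lemma zeta_facts (r : ℝ) (hr : 4 ≤ r) : 1 < zeta1 r ∧ zeta1 r ≤ zeta2 r ∧
    zeta1 r + zeta2 r = r ∧ zeta1 r * zeta2 r = r := by
  have h0 : 0 ≤ r ^ 2 - 4 * r := by nlinarith
  have hs := Real.sq_sqrt h0
  have hs0 := Real.sqrt_nonneg (r ^ 2 - 4 * r)
  have h2 : Real.sqrt (r ^ 2 - 4 * r) < r - 2 := by
    rw [Real.sqrt_lt' (by linarith)]; nlinarith
  unfold zeta1 zeta2
  refine ⟨by linarith, by linarith, by ring, by nlinarith⟩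

/-- ratio dynamics -/
lemma ratio_lower (r z1 z2 : ℝ) (hz : z1 ≤ z2) (hs : z1 + z2 = r)
    (hm : z1 * z2 = r) (q : ℕ → ℝ) (hq : ∀ n, 1 < q n) (h : ∀ n, q (n + 1) ≤ r - r / q n) :
    ∀ n, z1 ≤ q n := by
  intro N
  by_contra hN
  push Not at hN
  have hpos : ∀ n, 0 < q n := fun n => by linarith [hq n]
  have key : ∀ n, q (n + 1) ≤ q n - (z1 - q n) * (z2 - q n) / q n := by
    intro n
    have : q n - (z1 - q n) * (z2 - q n) / q n = r - r / q n := by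
      have := (hpos n).ne'
      field_simp
      rw [← hs] at *
      linear_combination -hm
    rw [this]; exact h n
  set c := (z1 - q N) * (z2 - q N) / q N with hc
  have hc0 : 0 < c := div_pos (mul_pos (by linarith) (by linarith)) (hpos N)
  have mono : ∀ n, q (N + n) ≤ q N ∧ q (N + n + 1) ≤ q (N + n) - c := by
    have step : ∀ n, q (N + n) ≤ q N → q (N + n + 1) ≤ q (N + n) - c := by
      intro n hn
      refine (key (N + n)).trans ?_
      have : c ≤ (z1 - q (N + n)) * (z2 - q (N + n)) / q (N + n) := by
        apply div_le_div₀ _ _ (hpos _) hn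
        · exact mul_nonneg (by linarith) (by linarith)
        · exact mul_le_mul (by linarith) (by linarith) (by linarith) (by linarith)
      linarith
    intro n
    induction n with
    | zero => exact ⟨le_refl _, step 0 (le_refl _)⟩
    | succ n ih =>
      have h1 : q (N + (n + 1)) ≤ q N := by
        have := ih.2
        rw [← add_assoc]; linarith [ih.1]
      exact ⟨h1, step _ h1⟩
  exact no_descent (fun n => q (N + n)) c hc0 (fun n => (hpos _).le) (fun n => (mono n).2)

lemma ratio_upper (r z1 z2 b : ℝ) (hr : 0 < r) (hz : z1 ≤ z2) (hs : z1 + z2 = r)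
    (hm : z1 * z2 = r) (hb : z2 < b) (q : ℕ → ℝ) (hq : ∀ n, 1 < q n)
    (h : ∀ n, q (n + 1) ≤ r - r / q n) :
    ∃ N, ∀ n, N ≤ n → q n ≤ b := by
  have hpos : ∀ n, 0 < q n := fun n => by linarith [hq n]
  have key : ∀ n, q (n + 1) ≤ q n - (q n - z1) * (q n - z2) / q n := by
    intro n
    have : q n - (q n - z1) * (q n - z2) / q n = r - r / q n := by
      have := (hpos n).ne'
      field_simp
      rw [← hs] at *
      linear_combination -hm
    rw [this]; exact h n
  have hle : ∀ n, q (n + 1) ≤ r := fun n => (h n).trans (by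
    have := div_pos hr (hpos n); linarith)
  have ex : ∃ N, q N ≤ b := by
    by_contra hne
    push Not at hne
    refine no_descent (fun n => q (n + 1)) ((b - z1) * (b - z2) / r)
      (div_pos (mul_pos (by linarith) (by linarith)) hr) (fun n => (hpos _).le) (fun n => ?_)
    refine (key (n + 1)).trans ?_
    have := hne (n + 1)
    have : (b - z1) * (b - z2) / r ≤ (q (n+1) - z1) * (q (n+1) - z2) / q (n+1) := by
      apply div_le_div₀ _ _ (hpos _) (hle _)
      · exact mul_nonneg (by linarith) (by linarith)
      · exact mul_le_mul (by linarith) (by linarith) (by linarith) (by linarith)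
    linarith
  obtain ⟨N, hN⟩ := ex
  refine ⟨N, fun n hn => ?_⟩
  induction n, hn using Nat.le_induction with
  | base => exact hN
  | succ n hn ih =>
    have hb0 : 0 < b := lt_of_lt_of_le (hpos n) ih
    have h1 : r / b ≤ r / q n := div_le_div_of_nonneg_left hr.le (hpos n) ih
    have h2 : b - (b - z1) * (b - z2) / b = r - r / b := by
      field_simp
      rw [← hs] at *
      linear_combination -hm
    have h3 : 0 ≤ (b - z1) * (b - z2) / b :=
      div_nonneg (mul_nonneg (by linarith) (by linarith)) hb0.le
    linarith [h n]

lemma choose_exp (z1 z2 m ρ : ℝ) (p : ℕ) (hp : 0 < p) (h1 : 1 < z1) (hz : z1 ≤ z2)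
    (hρ : 0 < ρ) (hm : ρ < m)
    (h : ∀ y, z1 ≤ y → y ≤ z2 → Real.log m ≤ 1 / (p : ℝ) * Real.log y - Real.log (1 - 1 / y)) :
    ∃ a b : ℝ, 0 ≤ a ∧ a * p < 1 ∧ z2 < b ∧
      ∀ y, z1 ≤ y → y ≤ b → Real.log ρ + Real.log (1 - 1 / y) ≤ a * Real.log y := by
  have hp' : (0 : ℝ) < p := by exact_mod_cast hp
  have hlog : Real.log ρ < Real.log m := Real.log_lt_log hρ hm
  have hz2 : 0 < Real.log z2 := Real.log_pos (by linarith)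
  set ε := min (1 / (p : ℝ)) ((Real.log m - Real.log ρ) / (2 * Real.log z2)) with hε
  have hε0 : 0 < ε := lt_min (by positivity) (div_pos (by linarith) (by positivity))
  have hε1 : ε ≤ 1 / p := min_le_left _ _
  have hε2 : ε * Real.log z2 ≤ (Real.log m - Real.log ρ) / 2 := by
    have : ε ≤ (Real.log m - Real.log ρ) / (2 * Real.log z2) := min_le_right _ _
    rw [le_div_iff₀ (by positivity)] at this
    linarith
  have main : ∀ y, z1 ≤ y → y ≤ z2 →
      Real.log ρ + Real.log (1 - 1 / y) < (1 / p - ε) * Real.log y := by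
    intro y hy1 hy2
    have := h y hy1 hy2
    have h3 : Real.log y ≤ Real.log z2 := Real.log_le_log (by linarith) hy2
    have h4 := mul_le_mul_of_nonneg_left h3 hε0.le
    nlinarith
  have hne : 1 - 1 / z2 ≠ 0 := by
    have : 1 / z2 < 1 := by rw [div_lt_one (by linarith)]; linarith
    linarith
  have c1 : ContinuousAt (fun y : ℝ => Real.log ρ + Real.log (1 - 1 / y)) z2 := by
    have : z2 ≠ 0 := by linarith
    fun_prop (disch := assumption)
  have c2 : ContinuousAt (fun y : ℝ => (1 / p - ε) * Real.log y) z2 := by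
    have : z2 ≠ 0 := by linarith
    fun_prop (disch := assumption)
  have ev := c1.eventually_lt c2 (main z2 hz le_rfl)
  obtain ⟨δ, hδ, hev⟩ := Metric.eventually_nhds_iff.1 ev
  refine ⟨1 / p - ε, z2 + δ / 2, by linarith, ?_, by linarith, ?_⟩
  · rw [sub_mul, one_div, inv_mul_cancel₀ hp'.ne']
    nlinarith
  · intro y hy1 hy2
    by_cases hy : y ≤ z2
    · exact (main y hy1 hy).le
    · push Not at hy
      refine (hev ?_).le
      rw [Real.dist_eq, abs_lt]
      constructor <;> linarith

noncomputable def CC (X : ℕ → ℝ) (n : ℕ) : ℝ := ∑ j ∈ Finset.range (n + 1), X j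

noncomputable def ww (ρ : ℝ) (X : ℕ → ℝ) (n : ℕ) : ℝ :=
  max 0 (Real.log (ρ * X n) - Real.log (CC X n))

lemma CC_succ (X : ℕ → ℝ) (n : ℕ) : CC X (n + 1) = CC X n + X (n + 1) := by
  unfold CC; rw [Finset.sum_range_succ]

lemma CC_pos {X : ℕ → ℝ} (h : IsSchedule X) (n : ℕ) : 0 < CC X n :=
  Finset.sum_pos (fun i _ => h.2 i) ⟨0, by simp⟩

lemma CC_mono {X : ℕ → ℝ} (h : IsSchedule X) : StrictMono (CC X) :=
  strictMono_nat_of_lt_succ fun n => by rw [CC_succ]; linarith [h.2 (n + 1)]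

lemma CC_ge {X : ℕ → ℝ} (h : IsSchedule X) (n : ℕ) : n * X 0 ≤ CC X n := by
  induction n with
  | zero => simpa using (CC_pos h 0).le
  | succ n ih =>
    rw [CC_succ]; push_cast
    have := h.1.monotone (Nat.zero_le (n + 1))
    linarith

lemma CC_large {X : ℕ → ℝ} (h : IsSchedule X) (R : ℝ) : ∃ n, R < CC X n := by
  obtain ⟨n, hn⟩ := exists_nat_gt (R / X 0)
  rw [div_lt_iff₀ (h.2 0)] at hn
  exact ⟨n, hn.trans_le (CC_ge h n)⟩

lemma sum_bound (r ρ z1 z2 a b : ℝ) (hr : 0 < r) (hρ : 0 < ρ) (hz : z1 ≤ z2)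
    (hs : z1 + z2 = r)
    (hm : z1 * z2 = r) (hb : z2 < b) (ha : 0 ≤ a)
    (hab : ∀ y, z1 ≤ y → y ≤ b → Real.log ρ + Real.log (1 - 1 / y) ≤ a * Real.log y)
    (X : ℕ → ℝ) (hX : IsSchedule X) (hrob : IsRobust r X) :
    ∃ K, ∀ n, ∑ i ∈ Finset.range (n + 1), ww ρ X i ≤ K + a * Real.log (CC X n) := by
  have hpos := CC_pos hX
  have hq : ∀ n, 1 < CC X (n + 1) / CC X n := fun n => by
    rw [one_lt_div (hpos n)]; exact CC_mono hX (Nat.lt_succ_self n)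
  have hstep : ∀ n, CC X (n + 1 + 1) / CC X (n + 1) ≤ r - r / (CC X (n + 1) / CC X n) := by
    intro n
    have h1 := hrob.2 (n + 2) (by omega)
    have h2 : CC X (n + 2) ≤ r * X (n + 1) := h1
    have h3 : X (n + 1) = CC X (n + 1) - CC X n := by rw [CC_succ]; ring
    rw [h3] at h2
    have h4 : r - r / (CC X (n + 1) / CC X n) = r * (CC X (n + 1) - CC X n) / CC X (n + 1) := by
      have := (hpos n).ne'
      have := (hpos (n + 1)).ne'
      field_simp
    rw [h4]
    exact div_le_div_of_nonneg_right h2 (hpos _).le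
  have hlow := ratio_lower r z1 z2 hz hs hm _ hq hstep
  obtain ⟨N, hN⟩ := ratio_upper r z1 z2 b hr hz hs hm hb _ hq hstep
  have hw : ∀ n, N ≤ n → ww ρ X (n + 1) ≤
      a * (Real.log (CC X (n + 1)) - Real.log (CC X n)) := by
    intro n hn
    have h1 := hab _ (hlow n) (hN n hn)
    have h2 : Real.log (CC X (n + 1) / CC X n) = Real.log (CC X (n + 1)) - Real.log (CC X n) :=
      Real.log_div (hpos _).ne' (hpos _).ne'
    have h3 : 1 - 1 / (CC X (n + 1) / CC X n) = X (n + 1) / CC X (n + 1) := by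
      have := (hpos n).ne'
      have := (hpos (n + 1)).ne'
      field_simp
      rw [CC_succ]; ring
    rw [h3, Real.log_div (hX.2 _).ne' (hpos _).ne', h2] at h1
    refine max_le (mul_nonneg ha ?_) ?_
    · rw [← h2]; exact (Real.log_pos (hq n)).le
    · rw [Real.log_mul hρ.ne' (hX.2 _).ne']; linarith
  have hw0 : ∀ i, 0 ≤ ww ρ X i := fun i => le_max_left _ _
  have hL : ∀ n, a * Real.log (CC X 0) ≤ a * Real.log (CC X n) := fun n =>
    mul_le_mul_of_nonneg_left
      (Real.log_le_log (hpos 0) ((CC_mono hX).monotone (Nat.zero_le n))) ha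
  refine ⟨∑ i ∈ Finset.range (N + 1), ww ρ X i - a * Real.log (CC X 0), fun n => ?_⟩
  by_cases hn : n ≤ N
  · have : ∑ i ∈ Finset.range (n + 1), ww ρ X i ≤ ∑ i ∈ Finset.range (N + 1), ww ρ X i :=
      Finset.sum_le_sum_of_subset_of_nonneg (Finset.range_mono (by omega)) (fun i _ _ => hw0 i)
    linarith [hL n]
  · push Not at hn
    replace hn := hn.le
    induction n, hn using Nat.le_induction with
    | base => linarith [hL N]
    | succ n hn ih =>
      rw [Finset.sum_range_succ]
      linarith [hw n hn]

lemma ell_nonneg {X : ℕ → ℝ} (hX : IsSchedule X) (T : ℝ) : 0 ≤ ell X T := by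
  apply Real.sSup_nonneg
  rintro y ⟨i, rfl, _⟩
  exact (hX.2 i).le

lemma ell_attained {X : ℕ → ℝ} (hX : IsSchedule X) (T : ℝ) (h : 0 < ell X T) :
    ∃ i, ell X T = X i ∧ CC X i ≤ T := by
  have hne : {y : ℝ | ∃ i : ℕ, y = X i ∧ ∑ j ∈ Finset.range (i + 1), X j ≤ T}.Nonempty := by
    by_contra hne
    rw [Set.not_nonempty_iff_eq_empty] at hne
    unfold ell at h
    rw [hne, Real.sSup_empty] at h
    exact lt_irrefl _ h
  have hfin : {y : ℝ | ∃ i : ℕ, y = X i ∧ ∑ j ∈ Finset.range (i + 1), X j ≤ T}.Finite := by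
    obtain ⟨n, hn⟩ := CC_large hX T
    refine ((Finset.range n).finite_toSet.image X).subset ?_
    rintro y ⟨i, rfl, hi⟩
    refine ⟨i, ?_, rfl⟩
    have : CC X i < CC X n := lt_of_le_of_lt hi hn
    simpa using (CC_mono hX).lt_iff_lt.1 this
  obtain ⟨i, hi, hi2⟩ := hne.csSup_mem hfin
  exact ⟨i, hi, hi2⟩

/-- measure covering -/
lemma cover_bound {ι : Type*} (s : Finset ι) (A B : ι → ℝ) (u v : ℝ)
    (h : ∀ t, u ≤ t → t ≤ v → ∃ i ∈ s, A i ≤ t ∧ t ≤ B i) :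
    v - u ≤ ∑ i ∈ s, max 0 (B i - A i) := by
  have h1 : Set.Icc u v ⊆ ⋃ i ∈ s, Set.Icc (A i) (B i) := by
    intro t ht
    obtain ⟨i, hi, hi2⟩ := h t ht.1 ht.2
    simp only [Set.mem_iUnion]
    exact ⟨i, hi, hi2⟩
  have h2 := (MeasureTheory.measure_mono (μ := MeasureTheory.volume) h1).trans
    (MeasureTheory.measure_biUnion_finset_le s _)
  simp only [Real.volume_Icc] at h2
  have h3 : ∀ i, ENNReal.ofReal (B i - A i) = ENNReal.ofReal (max 0 (B i - A i)) := by
    intro i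
    rcases le_total 0 (B i - A i) with h | h
    · rw [max_eq_right h]
    · rw [max_eq_left h, ENNReal.ofReal_of_nonpos h, ENNReal.ofReal_zero]
  simp only [h3] at h2
  rw [← ENNReal.ofReal_sum_of_nonneg (fun i _ => le_max_left _ _)] at h2
  exact (ENNReal.ofReal_le_ofReal_iff (Finset.sum_nonneg fun i _ => le_max_left _ _)).1 h2

lemma inf_bound (z1 z2 : ℝ) (p : ℕ) (hp : 0 < p) (h1 : 1 < z1)
    (y : ℝ) (hy1 : z1 ≤ y) (hy2 : y ≤ z2)
    (hm : 0 < sInf ((fun x : ℝ => x ^ (p + 1) / (x ^ p - 1)) ''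
      Set.Icc (z1 ^ (1 / (p : ℝ))) (z2 ^ (1 / (p : ℝ))))) :
    Real.log (sInf ((fun x : ℝ => x ^ (p + 1) / (x ^ p - 1)) ''
      Set.Icc (z1 ^ (1 / (p : ℝ))) (z2 ^ (1 / (p : ℝ))))) ≤
      1 / (p : ℝ) * Real.log y - Real.log (1 - 1 / y) := by
  have hp' : (0 : ℝ) < p := by exact_mod_cast hp
  have hy0 : 0 < y := by linarith
  have hx : (y ^ (1 / (p : ℝ))) ^ p = y := by
    rw [one_div]; exact Real.rpow_inv_natCast_pow hy0.le hp.ne'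
  have hle : sInf ((fun x : ℝ => x ^ (p + 1) / (x ^ p - 1)) ''
      Set.Icc (z1 ^ (1 / (p : ℝ))) (z2 ^ (1 / (p : ℝ)))) ≤ y ^ (1 / (p : ℝ)) / (1 - 1 / y) := by
    apply csInf_le
    · refine ⟨0, ?_⟩
      rintro _ ⟨x, hx, rfl⟩
      have : 1 ≤ x := (Real.one_le_rpow h1.le (by positivity)).trans hx.1
      have h2 : 1 ≤ x ^ p := one_le_pow₀ this
      exact div_nonneg (by positivity) (by linarith)
    · refine ⟨y ^ (1 / (p : ℝ)), ⟨?_, ?_⟩, ?_⟩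
      · exact Real.rpow_le_rpow (by linarith) hy1 (by positivity)
      · exact Real.rpow_le_rpow (by linarith) hy2 (by positivity)
      · simp only
        rw [pow_succ, hx]
        have : y - 1 ≠ 0 := by linarith
        have : 1 - 1 / y ≠ 0 := by
          have : 1 / y < 1 := by rw [div_lt_one hy0]; linarith
          linarith
        field_simp
  have h5 : 0 < 1 - 1 / y := by
    have : 1 / y < 1 := by rw [div_lt_one hy0]; linarith
    linarith
  have h6 := Real.log_le_log hm hle
  rwa [Real.log_div (Real.rpow_pos_of_pos hy0 _).ne' h5.ne', Real.log_rpow hy0] at h6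

theorem stmt_0 (r : ℝ) (hr : 4 ≤ r) (k : ℕ) (p : ℕ) (hp : p = 2 ^ k)
    (X : Fin p → ℕ → ℝ)
    (hsched : ∀ j, IsSchedule (X j))
    (hrob : ∀ j, IsRobust r (X j))
    (ρ : ℝ)
    (hρ : ∀ T : ℝ, (⨅ j, X j 0) ≤ T → T ≤ ρ * ⨆ j, ell (X j) T) :
    sInf ((fun x : ℝ => x ^ (p + 1) / (x ^ p - 1)) ''
      Set.Icc (zeta1 r ^ (1 / (p : ℝ))) (zeta2 r ^ (1 / (p : ℝ)))) ≤ ρ := by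
  have hp0 : 0 < p := by rw [hp]; positivity
  have hp' : (0 : ℝ) < p := by exact_mod_cast hp0
  haveI : Nonempty (Fin p) := ⟨⟨0, hp0⟩⟩
  obtain ⟨hz1, hz, hs, hm⟩ := zeta_facts r hr
  by_contra hlt
  push Not at hlt
  set T0 := ⨅ j, X j 0 with hT0
  have hT0pos : 0 < T0 := by
    obtain ⟨j, hj⟩ := exists_eq_ciInf_of_finite (f := fun j => X j 0)
    rw [hT0, ← hj]; exact (hsched j).2 0
  have hsupnn : ∀ T, 0 ≤ ⨆ j, ell (X j) T := fun T =>
    Real.iSup_nonneg fun j => ell_nonneg (hsched j) T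
  have hρ0 : 0 < ρ := by
    by_contra hneg
    push Not at hneg
    have := hρ T0 le_rfl
    nlinarith [hsupnn T0, mul_nonneg (neg_nonneg.2 hneg) (hsupnn T0)]
  have hcov : ∀ T, T0 ≤ T → ∃ j i, CC (X j) i ≤ T ∧ T ≤ ρ * X j i := by
    intro T hT
    have h1 := hρ T hT
    obtain ⟨j, hj⟩ := exists_eq_ciSup_of_finite (f := fun j => ell (X j) T)
    rw [← hj] at h1
    have hpos : 0 < ell (X j) T := by
      by_contra hneg
      push Not at hneg
      nlinarith [mul_nonneg hρ0.le (neg_nonneg.2 hneg)]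
    obtain ⟨i, hi, hi2⟩ := ell_attained (hsched j) T hpos
    exact ⟨j, i, hi2, by rw [← hi]; exact h1⟩
  obtain ⟨a, b, ha, hap, hb, hab⟩ := choose_exp (zeta1 r) (zeta2 r) _ ρ p hp0 hz1 hz hρ0 hlt
    (fun y hy1 hy2 => inf_bound (zeta1 r) (zeta2 r) p hp0 hz1 y hy1 hy2 (hρ0.trans hlt))
  choose K hK using fun j => sum_bound r ρ (zeta1 r) (zeta2 r) a b (by linarith) hρ0 hz hs hm hb
    ha hab (X j) (hsched j) (hrob j)
  have main : ∀ R, 0 < R → (∀ j, CC (X j) 0 ≤ R) →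
      Real.log R - Real.log T0 ≤ ∑ j, K j + p * (a * Real.log R) := by
    intro R hR hR0
    have hn : ∀ j, ∃ n, CC (X j) n ≤ R ∧ R < CC (X j) (n + 1) := by
      intro j
      classical
      have hex := CC_large (hsched j) R
      have h1 := Nat.find_spec hex
      have h2 : Nat.find hex ≠ 0 := by
        intro h0
        rw [h0] at h1
        exact absurd (hR0 j) (not_le.2 h1)
      obtain ⟨n, hn⟩ := Nat.exists_eq_succ_of_ne_zero h2
      refine ⟨n, ?_, by rw [hn] at h1; exact h1⟩
      exact not_lt.1 (Nat.find_min hex (by omega))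
    choose n hn1 hn2 using hn
    have hc := cover_bound ((Finset.univ : Finset (Fin p)).sigma
      (fun j => Finset.range (n j + 1)))
      (fun x => Real.log (CC (X x.1) x.2)) (fun x => Real.log (ρ * X x.1 x.2))
      (Real.log T0) (Real.log R) (by
        intro t ht1 ht2
        have ht1' : T0 ≤ Real.exp t := (Real.log_le_iff_le_exp hT0pos).1 ht1
        have ht2' : Real.exp t ≤ R := (Real.le_log_iff_exp_le hR).1 ht2
        obtain ⟨j, i, h1, h2⟩ := hcov _ ht1'
        refine ⟨⟨j, i⟩, ?_, ?_, ?_⟩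
        · simp only [Finset.mem_sigma, Finset.mem_univ, true_and, Finset.mem_range]
          exact (CC_mono (hsched j)).lt_iff_lt.1 (h1.trans_lt (ht2'.trans_lt (hn2 j)))
        · exact (Real.log_le_iff_le_exp (CC_pos (hsched j) i)).2 h1
        · exact (Real.le_log_iff_exp_le (mul_pos hρ0 ((hsched j).2 i))).2 h2)
    rw [Finset.sum_sigma] at hc
    refine hc.trans ?_
    calc _ ≤ ∑ j, (K j + a * Real.log R) := by
          apply Finset.sum_le_sum
          intro j _
          refine (hK j (n j)).trans ?_
          have := mul_le_mul_of_nonneg_left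
            (Real.log_le_log (CC_pos (hsched j) (n j)) (hn1 j)) ha
          linarith
      _ = _ := by
          rw [Finset.sum_add_distrib]; simp
  have hev : ∀ᶠ R in atTop, (0 < R ∧ ∀ j, CC (X j) 0 ≤ R) ∧
      (∑ j, K j + Real.log T0) / (1 - a * p) < Real.log R :=
    ((eventually_gt_atTop 0).and (eventually_all.2 fun j => eventually_ge_atTop _)).and
      (Real.tendsto_log_atTop.eventually_gt_atTop _)
  obtain ⟨R, ⟨hR, hR0⟩, hbig⟩ := hev.exists
  have h1 := main R hR hR0
  rw [div_lt_iff₀ (by linarith)] at hbig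
  nlinarith
end

section
/- Let r ≥ 4 and let X_0, …, X_{p−1} be r-robust schedules admitting a merged sorted enumeration ȳ. Then ζ_{1,r}^{1/p} ≤ liminf_{n→∞} ȳ(n)^{1/n} ≤ limsup_{n→∞} ȳ(n)^{1/n} ≤ ζ_{2,r}^{1/p}. -/
open Filter Finset

/-- `y` is a merged sorted enumeration of the contract lengths of `X 0, …, X (p-1)`. -/
def MergedSorted (p : ℕ) (X : Fin p → ℕ → ℝ) (y : ℕ → ℝ) : Prop :=
  Monotone y ∧ ∃ e : ℕ ≃ ℕ × Fin p, ∀ n : ℕ, y n = X (e n).2 (e n).1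

lemma zeta_sum (r : ℝ) : zeta1 r + zeta2 r = r := by
  unfold zeta1 zeta2; ring

lemma zeta_mul (r : ℝ) (hr : 4 ≤ r) : zeta1 r * zeta2 r = r := by
  have h : 0 ≤ r ^ 2 - 4 * r := by nlinarith
  have := Real.mul_self_sqrt h
  unfold zeta1 zeta2
  nlinarith

lemma zeta_le (r : ℝ) : zeta1 r ≤ zeta2 r := by
  have := Real.sqrt_nonneg (r ^ 2 - 4 * r)
  unfold zeta1 zeta2
  linarith

lemma one_lt_zeta1 (r : ℝ) (hr : 4 ≤ r) : 1 < zeta1 r := by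
  have h : Real.sqrt (r ^ 2 - 4 * r) < r - 2 := by
    rw [Real.sqrt_lt' (by linarith)]
    nlinarith
  unfold zeta1
  linarith

lemma sum_rec (r : ℝ) (X : ℕ → ℝ) (hX : IsRobust r X) (n : ℕ) :
    ∑ j ∈ range (n + 3), X j ≤
      r * (∑ j ∈ range (n + 2), X j - ∑ j ∈ range (n + 1), X j) := by
  have := hX.2 (n + 2) (by omega)
  rw [Finset.sum_range_succ _ (n + 1)]
  simpa using this

lemma D_rec (a b : ℝ) (hb : 0 < b) (S : ℕ → ℝ)
    (h : ∀ n, S (n + 2) ≤ (a + b) * S (n + 1) - a * b * S n) (m n : ℕ) :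
    S (m + n + 1) - a * S (m + n) ≤ b ^ n * (S (m + 1) - a * S m) := by
  induction n with
  | zero => simp
  | succ n ih =>
    have h1 := h (m + n)
    have h2 := mul_le_mul_of_nonneg_left ih hb.le
    have e1 : m + (n + 1) + 1 = m + n + 2 := by ring
    have e2 : m + (n + 1) = m + n + 1 := by ring
    rw [e1, e2, pow_succ]
    nlinarith

lemma S_upper (a b : ℝ) (ha : 1 < a) (hab : a ≤ b) (S : ℕ → ℝ) (hS : ∀ n, 0 < S n)
    (h : ∀ n, S (n + 2) ≤ (a + b) * S (n + 1) - a * b * S n) :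
    ∃ K > 0, ∀ n : ℕ, S n ≤ K * (n + 1) * b ^ n := by
  refine ⟨max (S 0) |S 1 - a * S 0|, lt_max_of_lt_left (hS 0), ?_⟩
  set K := max (S 0) |S 1 - a * S 0| with hK
  intro n
  induction n with
  | zero => simp [hK]
  | succ n ih =>
    have h1 := D_rec a b (by linarith) S h 0 n
    simp only [zero_add] at h1
    have h2 : S 1 - a * S 0 ≤ K := (le_abs_self _).trans (le_max_right _ _)
    have hK0 : 0 < K := lt_max_of_lt_left (hS 0)
    have hbn : 0 < b ^ n := pow_pos (by linarith) _
    have h3 : b ^ n * (S 1 - a * S 0) ≤ b ^ n * K := by gcongr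
    have h4 : a * S n ≤ b * S n := by
      have := hS n; gcongr
    have h5 : b * S n ≤ b * (K * (n + 1) * b ^ n) := by
      have : 0 ≤ b := by linarith
      gcongr
    have h6 : b ^ n * K ≤ b * (b ^ n * K) := by
      have : 0 < b ^ n * K := by positivity
      nlinarith
    push_cast
    rw [pow_succ]
    nlinarith

lemma S_lower (a b : ℝ) (ha : 1 < a) (hab : a ≤ b) (S : ℕ → ℝ) (hS : ∀ n, 0 < S n)
    (h : ∀ n, S (n + 2) ≤ (a + b) * S (n + 1) - a * b * S n) (n : ℕ) :
    S 0 * a ^ n ≤ S n := by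
  have key : ∀ m, a * S m ≤ S (m + 1) := by
    intro m
    by_contra hm
    push Not at hm
    set C := a * S m - S (m + 1) with hC
    have hC0 : 0 < C := by linarith
    have ha0 : 0 < a := by linarith
    have h1 : ∀ n : ℕ, S (m + n) * a ≤ a ^ n * (a * S m - n * C) := by
      intro n
      induction n with
      | zero => simp [mul_comm]
      | succ n ih =>
        have h2 := D_rec a b (by linarith) S h m n
        have h3 : a ^ n * C ≤ b ^ n * C := by gcongr
        have h4 : S (m + n + 1) ≤ a * S (m + n) - a ^ n * C := by
          have : b ^ n * (S (m + 1) - a * S m) = - (b ^ n * C) := by rw [hC]; ring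
          linarith
        rw [← add_assoc, pow_succ]
        push_cast
        nlinarith
    obtain ⟨n, hn⟩ := exists_nat_gt (a * S m / C)
    rw [div_lt_iff₀ hC0] at hn
    have h5 := h1 n
    have h6 : 0 < S (m + n) * a := mul_pos (hS _) ha0
    have h7 : 0 < a ^ n := pow_pos ha0 _
    nlinarith
  induction n with
  | zero => simp
  | succ n ih =>
    have := key n
    rw [pow_succ]
    nlinarith

lemma X_bounds (r : ℝ) (hr : 4 ≤ r) (X : ℕ → ℝ) (hs : IsSchedule X) (hX : IsRobust r X) :
    ∃ c > 0, ∃ K > 0, ∀ n : ℕ, c * zeta1 r ^ n ≤ X n ∧ X n ≤ K * (n + 1) * zeta2 r ^ n := by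
  have ha := one_lt_zeta1 r hr
  have hab := zeta_le r
  set S : ℕ → ℝ := fun n => ∑ j ∈ range (n + 1), X j with hSdef
  have hS : ∀ n, 0 < S n := fun n => Finset.sum_pos (fun i _ => hs.2 i) (by simp)
  have h : ∀ n, S (n + 2) ≤ (zeta1 r + zeta2 r) * S (n + 1) - zeta1 r * zeta2 r * S n := by
    intro n
    rw [zeta_sum, zeta_mul r hr, ← mul_sub]
    exact sum_rec r X hX n
  obtain ⟨K, hK, hKS⟩ := S_upper _ _ ha hab S hS h
  have hL := S_lower _ _ ha hab S hS h
  have hr0 : 0 < r := by linarith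
  refine ⟨S 0 / r, div_pos (hS 0) hr0, K, hK, fun n => ⟨?_, ?_⟩⟩
  · have h1 := hX.2 (n + 1) (by omega)
    simp only [Nat.add_sub_cancel] at h1
    have h2 := hL (n + 1)
    have h3 : S (n + 1) ≤ r * X n := h1
    have h4 : zeta1 r ^ n ≤ zeta1 r ^ (n + 1) := pow_le_pow_right₀ ha.le (by omega)
    have h5 := mul_le_mul_of_nonneg_left h4 (hS 0).le
    rw [div_mul_eq_mul_div, div_le_iff₀ hr0]
    linarith
  · refine le_trans ?_ (hKS n)
    exact Finset.single_le_sum (f := X) (fun i _ => (hs.2 i).le) (by simp)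

lemma merged_bounds (r : ℝ) (hr : 4 ≤ r) (p : ℕ) (hp : 0 < p)
    (X : Fin p → ℕ → ℝ)
    (hsched : ∀ j, IsSchedule (X j))
    (hrob : ∀ j, IsRobust r (X j))
    (y : ℕ → ℝ) (hmerge : MergedSorted p X y) :
    ∃ c > 0, ∃ K > 0, ∀ n : ℕ, c * zeta1 r ^ (n / p) ≤ y n ∧
      y n ≤ K * ((n / p : ℕ) + 1) * zeta2 r ^ (n / p) := by
  have ha := one_lt_zeta1 r hr
  have hab := zeta_le r
  choose c hc K hK hb using fun j => X_bounds r hr (X j) (hsched j) (hrob j)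
  obtain ⟨hy, e, he⟩ := hmerge
  have : Nonempty (Fin p) := ⟨⟨0, hp⟩⟩
  obtain ⟨j0, hj0⟩ := Finite.exists_min c
  obtain ⟨j1, hj1⟩ := Finite.exists_max K
  refine ⟨c j0, hc j0, K j1, hK j1, fun n => ⟨?_, ?_⟩⟩
  · have : ∃ m ≤ n, n / p ≤ (e m).1 := by
      by_contra hcon
      push Not at hcon
      have hsub : (range (n + 1)).map e.toEmbedding ⊆ (range (n / p)) ×ˢ (univ : Finset (Fin p)) := by
        intro q hq
        simp only [Finset.mem_map, Finset.mem_range] at hq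
        obtain ⟨m, hm, rfl⟩ := hq
        simpa using hcon m (by omega)
      have h1 := Finset.card_le_card hsub
      simp at h1
      have := Nat.div_mul_le_self n p
      omega
    obtain ⟨m, hm, hm2⟩ := this
    have h1 := (hb (e m).2 (e m).1).1
    rw [← he] at h1
    refine le_trans ?_ (h1.trans (hy hm))
    have := hc j0
    gcongr
    · exact (hc _).le
    · exact hj0 _
    · exact ha.le
  · have : ∃ m, n ≤ m ∧ (e m).1 ≤ n / p := by
      by_contra hcon
      push Not at hcon
      have hsub : ((range (n / p + 1)) ×ˢ (univ : Finset (Fin p))).map e.symm.toEmbedding ⊆ range n := by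
        intro m hm
        simp only [Finset.mem_map, Finset.mem_product, Finset.mem_range] at hm
        obtain ⟨q, ⟨hq, -⟩, rfl⟩ := hm
        by_contra h2
        have h3 := hcon (e.symm q) (by simpa using h2)
        simp at h3
        omega
      have h1 := Finset.card_le_card hsub
      simp at h1
      have := Nat.lt_div_mul_add (a := n) hp
      nlinarith
    obtain ⟨m, hm, hm2⟩ := this
    have h1 := (hb (e m).2 (e m).1).2
    rw [← he] at h1
    refine le_trans ((hy hm).trans h1) ?_
    have := hK j1
    have := hK (e m).2
    have h2 : 1 ≤ zeta2 r := by linarith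
    gcongr
    exact hj1 _

lemma tendsto_const_root (a : ℝ) (ha : 0 < a) :
    Tendsto (fun n : ℕ => a ^ (1 / (n : ℝ))) atTop (nhds 1) := by
  have h : Tendsto (fun n : ℕ => 1 / (n : ℝ)) atTop (nhds 0) := tendsto_one_div_atTop_nhds_zero_nat
  have h2 := ((Real.continuousAt_const_rpow (b := 0) ha.ne').tendsto).comp h
  simpa [Function.comp_def] using h2

lemma tendsto_nat_root :
    Tendsto (fun n : ℕ => (n : ℝ) ^ (1 / (n : ℝ))) atTop (nhds 1) :=
  tendsto_rpow_div.comp tendsto_natCast_atTop_atTop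

theorem stmt_3 (r : ℝ) (hr : 4 ≤ r) (p : ℕ)
    (X : Fin p → ℕ → ℝ)
    (hsched : ∀ j, IsSchedule (X j))
    (hrob : ∀ j, IsRobust r (X j))
    (y : ℕ → ℝ) (hmerge : MergedSorted p X y) :
    zeta1 r ^ (1 / (p : ℝ)) ≤ Filter.liminf (fun n : ℕ => y n ^ (1 / (n : ℝ))) Filter.atTop ∧
    Filter.liminf (fun n : ℕ => y n ^ (1 / (n : ℝ))) Filter.atTop ≤
      Filter.limsup (fun n : ℕ => y n ^ (1 / (n : ℝ))) Filter.atTop ∧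
    Filter.limsup (fun n : ℕ => y n ^ (1 / (n : ℝ))) Filter.atTop ≤ zeta2 r ^ (1 / (p : ℝ)) := by
  have hp : 0 < p := by
    obtain ⟨-, e, -⟩ := hmerge
    exact (Nat.zero_le _).trans_lt (e 0).2.isLt
  obtain ⟨c, hc, K, hK, hb⟩ := merged_bounds r hr p hp X hsched hrob y hmerge
  have ha := one_lt_zeta1 r hr
  have hab := zeta_le r
  have ha0 : 0 < zeta1 r := by linarith
  have hb0 : 0 < zeta2 r := by linarith
  have hp' : (0 : ℝ) < p := by exact_mod_cast hp
  set a := zeta1 r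
  set b := zeta2 r
  set L : ℕ → ℝ := fun n => (c / a) ^ (1 / (n : ℝ)) * a ^ (1 / (p : ℝ)) with hL
  set U : ℕ → ℝ := fun n => (2 * K) ^ (1 / (n : ℝ)) * (n : ℝ) ^ (1 / (n : ℝ)) * b ^ (1 / (p : ℝ)) with hU
  have hLt : Tendsto L atTop (nhds (a ^ (1 / (p : ℝ)))) := by
    simpa [hL] using (tendsto_const_root (c / a) (by positivity)).mul_const (a ^ (1 / (p : ℝ)))
  have hUt : Tendsto U atTop (nhds (b ^ (1 / (p : ℝ)))) := by
    simpa [hU] using ((tendsto_const_root (2 * K) (by positivity)).mul tendsto_nat_root).mul_const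
      (b ^ (1 / (p : ℝ)))
  have hroot : ∀ x : ℝ, 0 < x → ∀ n : ℕ, 1 ≤ n →
      (x ^ ((n : ℝ) / p)) ^ (1 / (n : ℝ)) = x ^ (1 / (p : ℝ)) := by
    intro x hx n hn
    have : (n : ℝ) ≠ 0 := by positivity
    rw [← Real.rpow_mul hx.le]
    congr 1
    field_simp
  have hLy : ∀ᶠ n : ℕ in atTop, L n ≤ y n ^ (1 / (n : ℝ)) := by
    filter_upwards [eventually_ge_atTop 1] with n hn
    have h1 : c / a * a ^ ((n : ℝ) / p) ≤ y n := by
      refine le_trans ?_ (hb n).1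
      have h2 : (n : ℝ) / p ≤ (n / p : ℕ) + 1 := by
        rw [div_le_iff₀ hp']
        have := Nat.lt_div_mul_add (a := n) hp
        have h3 : n ≤ (n / p + 1) * p := by nlinarith
        exact_mod_cast h3
      have h4 : a ^ ((n : ℝ) / p) ≤ a ^ (((n / p : ℕ) : ℝ) + 1) :=
        Real.rpow_le_rpow_of_exponent_le ha.le h2
      rw [Real.rpow_add_one ha0.ne', Real.rpow_natCast] at h4
      calc c / a * a ^ ((n : ℝ) / p) ≤ c / a * (a ^ (n / p) * a) := by gcongr
        _ = c * a ^ (n / p) := by field_simp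
    have h5 := Real.rpow_le_rpow (by positivity) h1 (by positivity : 0 ≤ 1 / (n : ℝ))
    rwa [Real.mul_rpow (by positivity) (by positivity), hroot a ha0 n hn] at h5
  have hyU : ∀ᶠ n : ℕ in atTop, y n ^ (1 / (n : ℝ)) ≤ U n := by
    filter_upwards [eventually_ge_atTop 1] with n hn
    have hy0 : 0 ≤ y n := le_trans (by positivity) (hb n).1
    have h1 : y n ≤ 2 * K * n * b ^ ((n : ℝ) / p) := by
      refine (hb n).2.trans ?_
      have h2 : ((n / p : ℕ) : ℝ) ≤ (n : ℝ) / p := Nat.cast_div_le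
      have h4 : b ^ (((n / p : ℕ) : ℝ)) ≤ b ^ ((n : ℝ) / p) :=
        Real.rpow_le_rpow_of_exponent_le (by linarith) h2
      rw [Real.rpow_natCast] at h4
      have h5 : ((n / p : ℕ) : ℝ) ≤ n := by exact_mod_cast Nat.div_le_self n p
      have h6 : (1 : ℝ) ≤ n := by exact_mod_cast hn
      have h7 : K * (((n / p : ℕ) : ℝ) + 1) ≤ 2 * K * n := by nlinarith
      gcongr
    have h5 := Real.rpow_le_rpow hy0 h1 (by positivity : 0 ≤ 1 / (n : ℝ))
    rwa [Real.mul_rpow (by positivity) (by positivity), hroot b hb0 n hn,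
      Real.mul_rpow (by positivity) (by positivity)] at h5
  have hbddA : IsBoundedUnder (· ≤ ·) atTop (fun n : ℕ => y n ^ (1 / (n : ℝ))) :=
    hUt.isBoundedUnder_le.mono_le hyU
  have hbddB : IsBoundedUnder (· ≥ ·) atTop (fun n : ℕ => y n ^ (1 / (n : ℝ))) :=
    hLt.isBoundedUnder_ge.mono_ge hLy
  refine ⟨?_, liminf_le_limsup hbddA hbddB, ?_⟩
  · rw [← hLt.liminf_eq]
    exact liminf_le_liminf hLy hLt.isBoundedUnder_ge hbddA.isCoboundedUnder_ge
  · rw [← hUt.limsup_eq]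
    exact limsup_le_limsup hyU hbddB.isCoboundedUnder_le hUt.isBoundedUnder_le
end

section
/- Let r > 4 be a fixed real and let (z_i)_{i=0}^∞ be a nonnegative real sequence such that ∑_{i=0}^n z_i ≤ r·z_{n−1} for all n ≥ 2. Then for every i ≥ 0 one has (ζ_{1,r} − 1)·ζ_{1,r}^i·z_0 ≤ z_{i+1} ≤ ((ζ_{2,r}^{i+1} − ζ_{1,r}^{i+1})/(ζ_{2,r} − ζ_{1,r}))·z_1. -/
open Finset

theorem stmt_4 (r : ℝ) (hr : 4 < r) (z : ℕ → ℝ)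
    (hnonneg : ∀ i, 0 ≤ z i)
    (hrec : ∀ n : ℕ, 2 ≤ n → ∑ i ∈ Finset.range (n + 1), z i ≤ r * z (n - 1)) :
    ∀ i : ℕ, (zeta1 r - 1) * zeta1 r ^ i * z 0 ≤ z (i + 1) ∧
      z (i + 1) ≤ (zeta2 r ^ (i + 1) - zeta1 r ^ (i + 1)) / (zeta2 r - zeta1 r) * z 1 := by
  have hs2 : Real.sqrt (r ^ 2 - 4 * r) ^ 2 = r ^ 2 - 4 * r := Real.sq_sqrt (by nlinarith)
  have hs0 : 0 < Real.sqrt (r ^ 2 - 4 * r) := Real.sqrt_pos.2 (by nlinarith)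
  have hsum : zeta1 r + zeta2 r = r := by unfold zeta1 zeta2; ring
  have hprod : zeta1 r * zeta2 r = r := by unfold zeta1 zeta2; linear_combination (-1 / 4) * hs2
  have hlt : zeta1 r < zeta2 r := by unfold zeta1 zeta2; linarith
  have hone : 1 < zeta1 r := by
    have : Real.sqrt (r ^ 2 - 4 * r) < r - 2 := by
      rw [Real.sqrt_lt' (by linarith)]; nlinarith
    unfold zeta1; linarith
  generalize zeta1 r = a at *
  generalize zeta2 r = b at *
  obtain ⟨S, hS⟩ : ∃ S : ℕ → ℝ, ∀ n, S n = ∑ i ∈ Finset.range (n + 1), z i := ⟨_, fun _ => rfl⟩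
  have hS0 : S 0 = z 0 := by simp [hS]
  have hSs : ∀ n, S (n + 1) = S n + z (n + 1) := by
    intro n; rw [hS, hS, Finset.sum_range_succ]
  have hSn : ∀ n, 0 ≤ S n := fun n => by rw [hS]; exact Finset.sum_nonneg fun i _ => hnonneg i
  have hR : ∀ n, S (n + 2) ≤ r * z (n + 1) := by
    intro n; rw [hS]; exact hrec (n + 2) (by omega)
  have hstep : ∀ n, S (n + 2) - a * S (n + 1) ≤ b * (S (n + 1) - a * S n) := by
    intro n
    have h1 := hR n
    have h2 := hSs n
    have h3 : z (n + 1) = S (n + 1) - S n := by linarith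
    have h4 : (a + b) * S (n + 1) = r * S (n + 1) := by rw [hsum]
    have h5 : (a * b) * S n = r * S n := by rw [hprod]
    rw [h3] at h1
    linarith
  have hb : 1 < b := hone.trans hlt
  have ha0 : 0 < a := by linarith
  have hgeo : ∀ n k, S (n + k + 1) - a * S (n + k) ≤ b ^ k * (S (n + 1) - a * S n) := by
    intro n k
    induction k with
    | zero => simp
    | succ k ih =>
      have h1 := hstep (n + k)
      have h2 := mul_le_mul_of_nonneg_left ih (by linarith : (0 : ℝ) ≤ b)
      calc _ ≤ _ := h1
        _ ≤ _ := h2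
        _ = _ := by ring
  have hlow : ∀ n, a * S n ≤ S (n + 1) := by
    intro n
    by_contra! hD
    have hk : ∀ k : ℕ, a * S (n + k) ≤ a ^ k * (a * S n + k * (S (n + 1) - a * S n)) := by
      intro k
      induction k with
      | zero => simp
      | succ k ih =>
        have h1 := hgeo n k
        have h2 : a ^ k ≤ b ^ k := pow_le_pow_left₀ ha0.le hlt.le k
        have h3 : b ^ k * (S (n + 1) - a * S n) ≤ a ^ k * (S (n + 1) - a * S n) :=
          mul_le_mul_of_nonpos_right h2 (by linarith)
        have h4 : S (n + k + 1) ≤ a * S (n + k) + a ^ k * (S (n + 1) - a * S n) := by linarith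
        have h5 := mul_le_mul_of_nonneg_left (h4.trans (add_le_add_left ih _)) ha0.le
        calc _ ≤ _ := h5
          _ = _ := by push_cast; ring
    obtain ⟨k, hk'⟩ := exists_nat_gt (a * S n / (a * S n - S (n + 1)))
    rw [div_lt_iff₀ (by linarith)] at hk'
    have h1 : a ^ k * (a * S n + k * (S (n + 1) - a * S n)) < 0 :=
      mul_neg_of_pos_of_neg (by positivity) (by linarith)
    have h2 := mul_nonneg ha0.le (hSn (n + k))
    linarith [hk k]
  have hpow : ∀ n, a ^ n * z 0 ≤ S n := by
    intro n
    induction n with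
    | zero => simp [hS0]
    | succ n ih =>
      have h1 := mul_le_mul_of_nonneg_left ih ha0.le
      calc _ = a * (a ^ n * z 0) := by ring
        _ ≤ _ := h1
        _ ≤ _ := hlow n
  have hup : ∀ n, (b - a) * S (n + 2) ≤ (b ^ (n + 2) - a ^ (n + 2)) * z 1 := by
    intro n
    induction n with
    | zero =>
      have h := mul_le_mul_of_nonneg_left (hR 0) (by linarith : 0 ≤ b - a)
      calc _ ≤ _ := h
        _ = _ := by rw [← hsum]; ring
    | succ n ih =>
      have h1 := hgeo 0 (n + 2)
      have h2 : S (0 + 1) - a * S 0 ≤ z 1 := by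
        have h := hSs 0
        have h3 : 0 ≤ (a - 1) * S 0 := mul_nonneg (by linarith) (hSn 0)
        simp only [zero_add] at *
        linarith
      have h3 := mul_le_mul_of_nonneg_left h2 (by positivity : 0 ≤ b ^ (n + 2))
      rw [zero_add (n + 2)] at h1
      have h4 : S (n + 2 + 1) ≤ a * S (n + 2) + b ^ (n + 2) * z 1 := by linarith
      have h5 := mul_le_mul_of_nonneg_left h4 (by linarith : 0 ≤ b - a)
      have h6 := mul_le_mul_of_nonneg_left ih ha0.le
      calc _ ≤ _ := h5
        _ = a * ((b - a) * S (n + 2)) + (b - a) * (b ^ (n + 2) * z 1) := by ring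
        _ ≤ _ := add_le_add_left h6 _
        _ = _ := by ring
  intro i
  constructor
  · have h1 := hlow i
    have h2 := mul_le_mul_of_nonneg_left (hpow i) (by linarith : 0 ≤ a - 1)
    have h3 := hSs i
    calc _ = (a - 1) * (a ^ i * z 0) := by ring
      _ ≤ _ := h2
      _ ≤ _ := by linarith
  · rw [div_mul_eq_mul_div, le_div_iff₀ (by linarith)]
    cases i with
    | zero => simp [mul_comm]
    | succ n =>
      have h1 := hup n
      have h2 : z (n + 2) ≤ S (n + 2) := by
        have := hSs (n + 1); have := hSn (n + 1)
        have e : S (n + 2) = S (n + 1) + z (n + 2) := hSs (n + 1)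
        linarith
      have h3 := mul_le_mul_of_nonneg_left h2 (by linarith : 0 ≤ b - a)
      calc _ = (b - a) * z (n + 2) := by ring
        _ ≤ _ := h3
        _ ≤ _ := h1
end

section
/- Let (z_i)_{i=0}^∞ be a nonnegative real sequence such that ∑_{i=0}^n z_i ≤ 4·z_{n−1} for all n ≥ 2. Then for every i ≥ 0 one has 2^i·z_0 ≤ z_{i+1} ≤ (i+1)·2^i·z_1. -/
open Finset

lemma aux_growth (S : ℕ → ℝ) (h : ∀ n, S (n+2) ≤ 4 * (S (n+1) - S n)) (m k : ℕ) :
    S (m+k+1) - 2 * S (m+k) ≤ 2^k * (S (m+1) - 2 * S m) ∧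
    S (m+k) ≤ 2^k * (S m + k / 2 * (S (m+1) - 2 * S m)) := by
  induction k with
  | zero => simp
  | succ k ih =>
    obtain ⟨h1, h2⟩ := ih
    have h3 := h (m+k)
    simp only [← add_assoc, pow_succ] at *
    push_cast
    constructor
    · have : S (m+k+1+1) ≤ 4 * (S (m+k+1) - S (m+k)) := h3
      linarith
    · nlinarith

theorem stmt_5 (z : ℕ → ℝ)
    (hnonneg : ∀ i, 0 ≤ z i)
    (hrec : ∀ n : ℕ, 2 ≤ n → ∑ i ∈ Finset.range (n + 1), z i ≤ 4 * z (n - 1)) :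
    ∀ i : ℕ, 2 ^ i * z 0 ≤ z (i + 1) ∧ z (i + 1) ≤ (i + 1) * 2 ^ i * z 1 := by
  obtain ⟨S, hS⟩ : ∃ S : ℕ → ℝ, ∀ n, S n = ∑ i ∈ Finset.range (n + 1), z i := ⟨_, fun _ => rfl⟩
  have hz : ∀ n, S (n+1) = S n + z (n+1) := fun n => by
    rw [hS, hS, Finset.sum_range_succ]
  have hpos : ∀ n, 0 ≤ S n := fun n => by
    rw [hS]; exact Finset.sum_nonneg fun i _ => hnonneg i
  have h0 : S 0 = z 0 := by simp [hS]
  have h : ∀ n, S (n+2) ≤ 4 * (S (n+1) - S n) := fun n => by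
    have h1 := hrec (n+2) (by omega)
    rw [← hS] at h1
    have h2 : n + 2 - 1 = n + 1 := by omega
    rw [h2] at h1
    linarith [hz n]
  have hD : ∀ m, 0 ≤ S (m+1) - 2 * S m := by
    intro m
    by_contra! hneg
    set d := S (m+1) - 2 * S m with hd
    obtain ⟨k, hk⟩ := exists_nat_gt (2 * S m / (-d))
    rw [div_lt_iff₀ (by linarith)] at hk
    have h2 := (aux_growth S h m k).2
    rw [← hd] at h2
    have h3 : (0:ℝ) < 2^k := by positivity
    have h4 : S m + k / 2 * d < 0 := by linarith
    have := mul_neg_of_pos_of_neg h3 h4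
    linarith [hpos (m+k)]
  have hlow : ∀ n, 2^n * z 0 ≤ S n := by
    intro n
    induction n with
    | zero => simp [h0]
    | succ n ih => rw [pow_succ]; linarith [hD n]
  intro i
  constructor
  · linarith [hlow i, hD i, hz i]
  · obtain ⟨h1, h2⟩ := aux_growth S h 0 i
    simp only [zero_add] at h1 h2
    have h3 := hz 0
    have h4 := hz i
    simp only [zero_add] at h3
    have e : S 1 - 2 * S 0 = z 1 - z 0 := by linarith
    rw [e] at h1 h2
    rw [h0] at h2
    have h5 : z (i+1) ≤ 2^i * (z 1 + i/2 * (z 1 - z 0)) := by linarith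
    have h6 : z 1 + i/2 * (z 1 - z 0) ≤ (i+1) * z 1 := by
      have a : 0 ≤ (i:ℝ) * z 0 := mul_nonneg (by positivity) (hnonneg 0)
      have b : 0 ≤ (i:ℝ) * z 1 := mul_nonneg (by positivity) (hnonneg 1)
      linarith
    have h7 := mul_le_mul_of_nonneg_left h6 (show (0:ℝ) ≤ 2^i by positivity)
    linarith
end

section
/- Let r ≥ 4 be a fixed real, and let (x_i)_{i=0}^∞ and (y_i)_{i=0}^∞ be real sequences such that ∑_{i=0}^n x_i ≤ r·x_{n−1} and ∑_{i=0}^n y_i = r·y_{n−1} for all n ≥ 2. If x_0 ≥ y_0 and x_1 ≤ y_1, then x_i ≤ y_i for all i ≥ 2. -/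
open Finset

theorem stmt_6 (r : ℝ) (hr : 4 ≤ r) (x y : ℕ → ℝ)
    (hx : ∀ n : ℕ, 2 ≤ n → ∑ i ∈ Finset.range (n + 1), x i ≤ r * x (n - 1))
    (hy : ∀ n : ℕ, 2 ≤ n → ∑ i ∈ Finset.range (n + 1), y i = r * y (n - 1))
    (h0 : x 0 ≥ y 0) (h1 : x 1 ≤ y 1) :
    ∀ i : ℕ, 2 ≤ i → x i ≤ y i := by
  obtain ⟨l, hl, hlr, hq⟩ : ∃ l : ℝ, 1 ≤ l ∧ l ≤ r ∧ l * (r - l) = r := by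
    have hs : Real.sqrt (r ^ 2 - 4 * r) ^ 2 = r ^ 2 - 4 * r := Real.sq_sqrt (by nlinarith)
    have hs0 := Real.sqrt_nonneg (r ^ 2 - 4 * r)
    have hsr : Real.sqrt (r ^ 2 - 4 * r) ≤ r := by
      apply Real.sqrt_le_iff.2
      constructor <;> nlinarith
    exact ⟨(r + Real.sqrt (r ^ 2 - 4 * r)) / 2, by linarith, by linarith, by nlinarith⟩
  obtain ⟨S, hS⟩ : ∃ S : ℕ → ℝ, ∀ n, S n = ∑ i ∈ Finset.range (n + 1), (x i - y i) :=
    ⟨_, fun _ => rfl⟩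
  have hS0 : S 0 = x 0 - y 0 := by simp [hS]
  have hSs : ∀ n, S (n + 1) = S n + (x (n + 1) - y (n + 1)) := by
    intro n
    rw [hS, hS, Finset.sum_range_succ _ (n + 1)]
  have hR : ∀ n, S (n + 2) ≤ r * (x (n + 1) - y (n + 1)) := by
    intro n
    have a := hx (n + 2) (by omega)
    have b := hy (n + 2) (by omega)
    rw [show n + 2 - 1 = n + 1 by omega] at a b
    rw [hS, Finset.sum_sub_distrib]
    linarith
  have hT : ∀ n, S (n + 1) ≤ l * S n := by
    intro n
    induction n with
    | zero =>
      have := hSs 0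
      simp only [zero_add] at *
      nlinarith
    | succ n ih =>
      have a := hR n
      have b := hSs n
      have c : S (n + 2) ≤ r * (S (n + 1) - S n) := by
        rw [b]; linarith
      have d : (r - l) * (S (n + 1) - l * S n) ≤ 0 :=
        mul_nonpos_of_nonneg_of_nonpos (by linarith) (by linarith)
      have e : (r - l) * (S (n + 1) - l * S n) = (r - l) * S (n + 1) - r * S n := by
        linear_combination (-S n) * hq
      change S (n + 2) ≤ l * S (n + 1)
      linarith
  have hN : ∀ n, S (n + 2) ≤ 0 := by
    intro n
    induction n with
    | zero =>
      have := hR 0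
      simp only [zero_add] at *
      nlinarith
    | succ n ih =>
      have := hT (n + 2)
      change S (n + 2 + 1) ≤ 0
      nlinarith
  intro i hi
  obtain ⟨n, rfl⟩ := Nat.exists_eq_add_of_le' hi
  cases n with
  | zero =>
    have a := hR 0
    have b := hSs 0
    have c := hSs 1
    norm_num at *
    nlinarith
  | succ n =>
    have a := hT (n + 2)
    have b := hSs (n + 2)
    have c := hN n
    change x (n + 2 + 1) ≤ y (n + 2 + 1)
    nlinarith
end

section
/- Let r ≥ 4 be a real number and define the sequence (A_k, B_k)_{k=1}^∞ of pairs of reals by A_1 = r − 1, B_1 = 1, and the recursion A_{k+1} = (r−1)·A_k − B_k, B_{k+1} = A_k + B_k. Then A_k ≥ 0 and B_k ≥ 0 for every k ≥ 1. -/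
theorem stmt_7 (r : ℝ) (hr : 4 ≤ r) (A B : ℕ → ℝ)
    (hA1 : A 1 = r - 1) (hB1 : B 1 = 1)
    (hrec : ∀ k : ℕ, 1 ≤ k → A (k + 1) = (r - 1) * A k - B k ∧ B (k + 1) = A k + B k) :
    ∀ k : ℕ, 1 ≤ k → 0 ≤ A k ∧ 0 ≤ B k := by
  have key : ∀ k : ℕ, 1 ≤ k → B k ≤ A k ∧ 0 ≤ B k := by
    intro k hk
    induction k, hk using Nat.le_induction with
    | base => rw [hA1, hB1]; constructor <;> linarith
    | succ n hn ih =>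
      obtain ⟨h1, h2⟩ := ih
      obtain ⟨ha, hb⟩ := hrec n hn
      have h3 : 0 ≤ (r - 4) * A n := mul_nonneg (by linarith) (by linarith)
      rw [ha, hb]
      constructor <;> linarith
  intro k hk
  obtain ⟨h1, h2⟩ := key k hk
  exact ⟨h2.trans h1, h2⟩
end

section
/- Let (y_i)_{i=0}^∞ be a real sequence satisfying ∑_{i=0}^n y_i = 4·y_{n−1} for all n ≥ 2. Then for every n ≥ 2, y_n = 2^{n−1}·y_1 + (n−1)·2^{n−2}·(y_1 − y_0). -/
open Finset

theorem stmt_10 (y : ℕ → ℝ)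
    (hrec : ∀ n : ℕ, 2 ≤ n → ∑ i ∈ Finset.range (n + 1), y i = 4 * y (n - 1)) :
    ∀ n : ℕ, 2 ≤ n →
      y n = 2 ^ (n - 1) * y 1 + ((n : ℝ) - 1) * 2 ^ (n - 2) * (y 1 - y 0) := by
  have h2 : y 2 = 3 * y 1 - y 0 := by
    have h := hrec 2 le_rfl
    simp [Finset.sum_range_succ] at h
    linarith
  have hstep : ∀ k : ℕ, y (k + 3) = 4 * y (k + 2) - 4 * y (k + 1) := by
    intro k
    have ha : ∑ i ∈ Finset.range (k + 3), y i = 4 * y (k + 1) := hrec (k + 2) (by omega)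
    have hb : ∑ i ∈ Finset.range (k + 3 + 1), y i = 4 * y (k + 2) := hrec (k + 3) (by omega)
    rw [Finset.sum_range_succ, ha] at hb
    linarith
  have key : ∀ k : ℕ,
      y (k + 2) = 2 ^ (k + 1) * y 1 + ((k : ℝ) + 1) * 2 ^ k * (y 1 - y 0) ∧
      y (k + 3) = 2 ^ (k + 2) * y 1 + ((k : ℝ) + 2) * 2 ^ (k + 1) * (y 1 - y 0) := by
    intro k
    induction k with
    | zero =>
      have h3 := hstep 0
      norm_num at h3 ⊢
      constructor <;> linarith
    | succ k ih =>
      obtain ⟨iha, ihb⟩ := ih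
      have h := hstep (k + 1)
      have e1 : k + 1 + 2 = k + 3 := by omega
      have e2 : k + 1 + 1 = k + 2 := by omega
      rw [e1, e2, iha, ihb] at h
      rw [e1, ihb, h]
      push_cast
      constructor <;> ring
  intro n hn
  obtain ⟨k, rfl⟩ := Nat.exists_eq_add_of_le' hn
  rw [(key k).1, show k + 2 - 1 = k + 1 by omega, show k + 2 - 2 = k by omega]
  push_cast
  ring
end

section
/- Let r ≥ 4 be a fixed real and let (z_i)_{i=0}^∞ be a nonnegative real sequence such that ∑_{i=0}^n z_i ≤ r·z_{n−1} for all n ≥ 2. Then for every j ≥ 0 one has (ζ_{1,r} − 1)·∑_{k=0}^j z_k ≤ z_{j+1}. -/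
open Finset

theorem stmt_11 (r : ℝ) (hr : 4 ≤ r) (z : ℕ → ℝ)
    (hnonneg : ∀ i, 0 ≤ z i)
    (hrec : ∀ n : ℕ, 2 ≤ n → ∑ i ∈ Finset.range (n + 1), z i ≤ r * z (n - 1)) :
    ∀ j : ℕ, (zeta1 r - 1) * ∑ k ∈ Finset.range (j + 1), z k ≤ z (j + 1) := by
  intro j
  have hs0 : 0 ≤ r ^ 2 - 4 * r := by nlinarith
  have hsq := Real.sq_sqrt hs0
  have hsn := Real.sqrt_nonneg (r ^ 2 - 4 * r)
  obtain ⟨a, ha⟩ : ∃ a, a = zeta1 r := ⟨_, rfl⟩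
  obtain ⟨b, hb⟩ : ∃ b, b = zeta2 r := ⟨_, rfl⟩
  have hab : a ≤ b := by rw [ha, hb, zeta1, zeta2]; linarith
  have hadd : a + b = r := by rw [ha, hb, zeta1, zeta2]; ring
  have hmul : a * b = r := by rw [ha, hb, zeta1, zeta2]; nlinarith
  have hbpos : 0 < b := by linarith
  have hapos : 0 < a := by
    by_contra h
    nlinarith [mul_nonneg (sub_nonneg.2 (not_lt.1 h)) hbpos.le]
  rw [← ha]
  obtain ⟨S, hS⟩ : ∃ S : ℕ → ℝ, ∀ n, S n = ∑ k ∈ Finset.range (n + 1), z k := ⟨_, fun _ => rfl⟩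
  have hSn : ∀ n, 0 ≤ S n := fun n => by
    rw [hS]; exact Finset.sum_nonneg fun i _ => hnonneg i
  have hz : ∀ n, S (n + 1) = S n + z (n + 1) := fun n => by
    rw [hS, hS, Finset.sum_range_succ]
  have hr' : ∀ n, S (n + 2) ≤ r * (S (n + 1) - S n) := fun n => by
    have h := hrec (n + 2) (by omega)
    rw [← hS, show n + 2 - 1 = n + 1 by omega] at h
    rw [hz n]; linarith
  rw [← hS]
  by_contra hcon
  obtain ⟨d, hd⟩ : ∃ d, d = a * S j - S (j + 1) := ⟨_, rfl⟩
  have hdpos : 0 < d := by have := hz j; linarith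
  have hD : ∀ m, S (j + m + 1) - a * S (j + m) ≤ - (b ^ m * d) := by
    intro m
    induction m with
    | zero => simp [hd]
    | succ m ih =>
      have h1 := hr' (j + m)
      have h2 := mul_le_mul_of_nonneg_left ih hbpos.le
      have h3 : b * (S (j + m + 1) - a * S (j + m)) = b * S (j + m + 1) - r * S (j + m) := by
        rw [← hmul]; ring
      have h4 : r * (S (j + m + 1) - S (j + m))
          = a * S (j + m + 1) + b * S (j + m + 1) - r * S (j + m) := by
        rw [← hadd]; ring
      have h5 : b * -(b ^ m * d) = -(b ^ (m + 1) * d) := by ring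
      rw [show j + (m + 1) + 1 = j + m + 2 by ring, show j + (m + 1) = j + m + 1 by ring]
      linarith
  have hB : ∀ m : ℕ, a * S (j + m) ≤ a ^ m * (a * S j - m * d) := by
    intro m
    induction m with
    | zero => simp
    | succ m ih =>
      have h1 := mul_le_mul_of_nonneg_left (hD m) hapos.le
      have h2 := mul_le_mul_of_nonneg_left ih hapos.le
      have h3 : a * (a ^ m * d) ≤ a * (b ^ m * d) := by gcongr
      rw [show j + (m + 1) = j + m + 1 by ring]
      have h4 : a ^ (m + 1) * (a * S j - ((m + 1 : ℕ) : ℝ) * d)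
          = a * (a ^ m * (a * S j - m * d)) - a * (a ^ m * d) := by
        push_cast; ring
      rw [h4]
      linarith
  obtain ⟨m, hm⟩ := exists_nat_gt (a * S j / d)
  rw [div_lt_iff₀ hdpos] at hm
  have h1 := hB m
  have h2 := mul_nonneg hapos.le (hSn (j + m))
  have h3 := mul_pos (pow_pos hapos m) (sub_pos.2 hm)
  linarith
end

section
/- Let (x_i)_{i=1}^∞ be a positive nondecreasing real sequence satisfying c_A·A^i ≤ x_i ≤ c_B·i^R·B^i for all i ≥ 1, where R ≥ 0, c_A, c_B > 0 and A, B > 1 are constants, and for t > 0 let f(t) denote the (finite) number of indices i ≥ 1 with x_i ≤ t. Then: (a) for every t > 0, f(t) > (log t − log c_B)/log B − 1 − (R/log B)·√(f(t)); and (b) for every t ≥ c_A, f(t) < (log t − log c_A)/log A + 1. -/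
theorem log_aux (n : ℕ) : Real.log ((n : ℝ) + 1) ≤ Real.sqrt n := by
  have hn : (0 : ℝ) ≤ n := Nat.cast_nonneg n
  have h0 := Real.sqrt_nonneg (n : ℝ)
  have h1 := Real.sq_sqrt hn
  set s := Real.sqrt (n : ℝ) with hs
  rw [Real.log_le_iff_le_exp (by positivity)]
  have h2 := Real.sum_le_exp_of_nonneg h0 4
  simp [Finset.sum_range_succ, Nat.factorial] at h2
  nlinarith [mul_nonneg h0 (sq_nonneg (s - 3 / 2)), mul_nonneg h0 h0]

theorem stmt_13 (R cA cB A B : ℝ)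
    (hR : 0 ≤ R) (hcA : 0 < cA) (hcB : 0 < cB) (hA : 1 < A) (hB : 1 < B)
    (x : ℕ → ℝ)
    (hpos : ∀ i : ℕ, 1 ≤ i → 0 < x i)
    (hmono : ∀ i i' : ℕ, 1 ≤ i → i ≤ i' → x i ≤ x i')
    (hbound : ∀ i : ℕ, 1 ≤ i →
      cA * A ^ (i : ℝ) ≤ x i ∧ x i ≤ cB * (i : ℝ) ^ R * B ^ (i : ℝ))
    (f : ℝ → ℕ)
    (hf : ∀ t : ℝ, f t = Nat.card {i : ℕ // 1 ≤ i ∧ x i ≤ t}) :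
    (∀ t : ℝ, 0 < t →
      (Real.log t - Real.log cB) / Real.log B - 1
        - (R / Real.log B) * Real.sqrt (f t) < (f t : ℝ)) ∧
    (∀ t : ℝ, cA ≤ t → (f t : ℝ) < (Real.log t - Real.log cA) / Real.log A + 1) := by
  have hlA : 0 < Real.log A := Real.log_pos hA
  have hlB : 0 < Real.log B := Real.log_pos hB
  have key : ∀ t : ℝ, t < x (f t + 1) ∧ (1 ≤ f t → x (f t) ≤ t) := by
    intro t
    have hex : ∃ m : ℕ, t < x (m + 1) := by
      obtain ⟨m, hm⟩ := pow_unbounded_of_one_lt (t / cA) hA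
      refine ⟨m, ?_⟩
      have h1 := (hbound (m + 1) (by omega)).1
      rw [Real.rpow_natCast] at h1
      have h2 : A ^ m ≤ A ^ (m + 1) := pow_le_pow_right₀ hA.le (by omega)
      rw [div_lt_iff₀ hcA] at hm
      nlinarith
    classical
    have hm := Nat.find_spec hex
    have hmin : ∀ k, k < Nat.find hex → x (k + 1) ≤ t := fun k hk =>
      not_lt.mp (Nat.find_min hex hk)
    have hcard : f t = Nat.find hex := by
      rw [hf, Nat.subtype_card (Finset.Icc 1 (Nat.find hex))]
      · simp
      · intro i
        rw [Finset.mem_Icc]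
        constructor
        · rintro ⟨h1, h2⟩
          refine ⟨h1, ?_⟩
          have := hmin (i - 1) (by omega)
          rwa [Nat.sub_add_cancel h1] at this
        · rintro ⟨h1, h2⟩
          refine ⟨h1, ?_⟩
          by_contra h3
          have := hmono (Nat.find hex + 1) i (by omega) (by omega)
          linarith
    rw [hcard]
    refine ⟨hm, fun h1 => ?_⟩
    have := hmin (Nat.find hex - 1) (by omega)
    rwa [Nat.sub_add_cancel h1] at this
  constructor
  · intro t ht
    have h1 := (key t).1
    have h2 := (hbound (f t + 1) (by omega)).2
    have h3 := Real.log_lt_log ht (h1.trans_le h2)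
    have hp : (0 : ℝ) < ((f t + 1 : ℕ) : ℝ) := by positivity
    have hB0 : 0 < B := by linarith
    rw [Real.log_mul (by positivity) (by positivity), Real.log_mul (by positivity) (by positivity),
      Real.log_rpow hp, Real.log_rpow hB0] at h3
    push_cast at h3
    have h4 := mul_le_mul_of_nonneg_left (log_aux (f t)) hR
    have h5 : (Real.log t - Real.log cB) / Real.log B - 1 - (R / Real.log B) * Real.sqrt (f t)
        = (Real.log t - Real.log cB - Real.log B - R * Real.sqrt (f t)) / Real.log B := by
      field_simp
    rw [h5, div_lt_iff₀ hlB]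
    linarith
  · intro t ht
    have ht0 : 0 < t := hcA.trans_le ht
    have hll := Real.log_le_log hcA ht
    rcases Nat.eq_zero_or_pos (f t) with h0 | h0
    · rw [h0]
      have : 0 ≤ (Real.log t - Real.log cA) / Real.log A := div_nonneg (by linarith) hlA.le
      push_cast
      linarith
    · have h1 := (key t).2 h0
      have h2 := (hbound (f t) h0).1
      have hA0 : 0 < A := by linarith
      have h3 := Real.log_le_log (by positivity) (h2.trans h1)
      rw [Real.log_mul (by positivity) (by positivity), Real.log_rpow hA0] at h3
      have : (f t : ℝ) ≤ (Real.log t - Real.log cA) / Real.log A := by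
        rw [le_div_iff₀ hlA]
        linarith
      linarith
end

section
/- For every real b > 1 and every integer n ≥ 0, ∑_{j=0}^n b^j ≤ (b²/(b−1))·b^{n−1}. Consequently, for every real r ≥ 4 and every b with ζ_{1,r} ≤ b ≤ ζ_{2,r}, one has ∑_{j=0}^n b^j ≤ r·b^{n−1} for all n ≥ 0; i.e., the geometric schedule G_b = (b^i)_{i=0}^∞ has acceleration ratio at most b²/(b−1) ≤ r. -/
open Finset

theorem stmt_14 :
    (∀ b : ℝ, 1 < b → ∀ n : ℕ,
      ∑ j ∈ Finset.range (n + 1), b ^ j ≤ b ^ 2 / (b - 1) * b ^ ((n : ℝ) - 1)) ∧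
    (∀ r : ℝ, 4 ≤ r → ∀ b : ℝ, zeta1 r ≤ b → b ≤ zeta2 r →
      b ^ 2 / (b - 1) ≤ r ∧
      ∀ n : ℕ, ∑ j ∈ Finset.range (n + 1), b ^ j ≤ r * b ^ ((n : ℝ) - 1)) := by
  have key : ∀ b : ℝ, 1 < b → ∀ n : ℕ,
      ∑ j ∈ Finset.range (n + 1), b ^ j ≤ b ^ 2 / (b - 1) * b ^ ((n : ℝ) - 1) := by
    intro b hb n
    have hb0 : 0 < b := by linarith
    have hb1 : 0 < b - 1 := by linarith
    rw [geom_sum_eq (ne_of_gt hb), Real.rpow_sub hb0, Real.rpow_natCast, Real.rpow_one]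
    have h : b ^ 2 / (b - 1) * (b ^ n / b) = b ^ (n + 1) / (b - 1) := by
      field_simp
      try ring
    rw [h]
    gcongr
    linarith
  refine ⟨key, ?_⟩
  intro r hr b h1 h2
  unfold zeta1 at h1
  unfold zeta2 at h2
  have hd : 0 ≤ r ^ 2 - 4 * r := by nlinarith
  have hs := Real.sq_sqrt hd
  have hs0 := Real.sqrt_nonneg (r ^ 2 - 4 * r)
  set s := Real.sqrt (r ^ 2 - 4 * r) with hsdef
  have hlt : s < r - 2 := by
    by_contra hc
    push Not at hc
    nlinarith
  have hb : 1 < b := by linarith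
  have hb1 : 0 < b - 1 := by linarith
  have hq : b ^ 2 / (b - 1) ≤ r := by
    rw [div_le_iff₀ hb1]
    nlinarith [mul_nonneg (sub_nonneg.2 h1) (sub_nonneg.2 h2)]
  refine ⟨hq, fun n => (key b hb n).trans ?_⟩
  have hp : 0 ≤ b ^ ((n : ℝ) - 1) := Real.rpow_nonneg (by linarith) _
  exact mul_le_mul_of_nonneg_right hq hp
end

section
/- Let r ≥ 4, let l ≥ 1 be an integer, and let b > 1 satisfy ζ_{1,r} ≤ b^l ≤ ζ_{2,r}. For 0 ≤ i ≤ l−1 define the schedule X_i = (b^{i+j·l})_{j=0}^∞. Then: (a) every X_i is r-robust, i.e., b^i ≤ r and ∑_{j=0}^n b^{i+j·l} ≤ r·b^{i+(n−1)·l} for all n ≥ 1; and (b) for every real T ≥ 1, max_{0≤i<l} ℓ(X_i, T) ≥ T·(b^l − 1)/b^{l+1}. -/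
open Finset

theorem aux_sum (b : ℝ) (l i n : ℕ) :
    (∑ j ∈ Finset.range (n + 1), b ^ (i + j * l)) * (b ^ l - 1) = b ^ (i + n * l + l) - b ^ i := by
  induction n with
  | zero => simp; ring
  | succ k ih =>
    rw [Finset.sum_range_succ, add_mul, ih]
    have : i + (k + 1) * l = i + k * l + l := by ring
    rw [this, pow_add _ _ l, pow_add _ _ l]
    ring

theorem le_ell_of (X : ℕ → ℝ) (T : ℝ) (hX : ∀ j, 0 ≤ X j) (n : ℕ)
    (h : ∑ j ∈ Finset.range (n + 1), X j ≤ T) : X n ≤ ell X T := by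
  unfold ell
  apply le_csSup
  · refine ⟨T, ?_⟩
    rintro y ⟨i, rfl, hi⟩
    exact (Finset.single_le_sum (f := X) (fun j _ => hX j)
      (Finset.self_mem_range_succ i)).trans hi
  · exact ⟨n, rfl, h⟩

theorem stmt_15 (r : ℝ) (hr : 4 ≤ r) (l : ℕ) (hl : 1 ≤ l) (b : ℝ) (hb : 1 < b)
    (h1 : zeta1 r ≤ b ^ l) (h2 : b ^ l ≤ zeta2 r) :
    (∀ i : ℕ, i ≤ l - 1 →
      b ^ i ≤ r ∧
      ∀ n : ℕ, 1 ≤ n →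
        ∑ j ∈ Finset.range (n + 1), b ^ (i + j * l) ≤ r * b ^ (i + (n - 1) * l)) ∧
    (∀ T : ℝ, 1 ≤ T →
      T * (b ^ l - 1) / b ^ (l + 1) ≤ ⨆ i : Fin l, ell (fun j => b ^ ((i : ℕ) + j * l)) T) := by
  have hb0 : 0 < b := by linarith
  have hq : 1 < b ^ l := one_lt_pow₀ hb (by omega)
  have hs0 := Real.sqrt_nonneg (r ^ 2 - 4 * r)
  have hs2 : Real.sqrt (r ^ 2 - 4 * r) ^ 2 = r ^ 2 - 4 * r := Real.sq_sqrt (by nlinarith)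
  unfold zeta1 at h1
  unfold zeta2 at h2
  have hsr : Real.sqrt (r ^ 2 - 4 * r) ≤ r := by
    apply Real.sqrt_le_iff.2
    constructor <;> linarith
  constructor
  · intro i hi
    refine ⟨?_, ?_⟩
    · have : b ^ i ≤ b ^ l := pow_le_pow_right₀ hb.le (by omega)
      linarith
    · intro n hn
      obtain ⟨k, rfl⟩ : ∃ k, n = k + 1 := ⟨n - 1, by omega⟩
      have hs := aux_sum b l i (k + 1)
      have hq2 : b ^ l * b ^ l ≤ r * (b ^ l - 1) := by
        nlinarith [mul_nonneg (sub_nonneg.2 h1) (sub_nonneg.2 h2)]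
      have e : i + (k + 1) * l + l = i + k * l + (l + l) := by ring
      rw [e, pow_add, pow_add _ l l] at hs
      have hp : 0 < b ^ (i + k * l) := by positivity
      have hi0 : 0 < b ^ i := by positivity
      have := mul_le_mul_of_nonneg_left hq2 hp.le
      simp only [Nat.add_sub_cancel]
      refine le_of_mul_le_mul_right ?_ (sub_pos.2 hq)
      rw [hs]
      linarith
  · intro T hT
    let D : ℕ → ℝ := fun m => ∑ j ∈ Finset.range (m / l + 1), b ^ (m % l + j * l)
    have hex : ∃ m, T < D m := by
      obtain ⟨m, hm⟩ := pow_unbounded_of_one_lt T hb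
      refine ⟨m, hm.trans_le ?_⟩
      have := Finset.single_le_sum (f := fun j => b ^ (m % l + j * l))
        (fun j _ => by positivity) (Finset.self_mem_range_succ (m / l))
      simpa [Nat.mod_add_div'] using this
    classical
    have hk := Nat.find_spec hex
    have hmin : ∀ m < Nat.find hex, D m ≤ T := fun m hm => not_lt.1 (Nat.find_min hex hm)
    have hk0 : Nat.find hex ≠ 0 := by
      intro h0
      rw [h0] at hk
      simp [D] at hk
      linarith
    obtain ⟨m, hm⟩ : ∃ m, Nat.find hex = m + 1 := ⟨Nat.find hex - 1, by omega⟩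
    rw [hm] at hk
    have hDm := hmin m (by omega)
    have h3 := le_ell_of (fun j => b ^ (m % l + j * l)) T (fun j => by positivity) (m / l) hDm
    have h4 : ell (fun j => b ^ (m % l + j * l)) T
        ≤ ⨆ i : Fin l, ell (fun j => b ^ ((i : ℕ) + j * l)) T :=
      le_ciSup (f := fun i : Fin l => ell (fun j => b ^ ((i : ℕ) + j * l)) T)
        (Set.finite_range _).bddAbove ⟨m % l, Nat.mod_lt _ (by omega)⟩
    refine le_trans ?_ (h3.trans h4)
    simp only [Nat.mod_add_div']
    have hs := aux_sum b l ((m + 1) % l) ((m + 1) / l)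
    rw [Nat.mod_add_div'] at hs
    have hp : 0 < b ^ ((m + 1) % l) := by positivity
    have h5 := mul_lt_mul_of_pos_right hk (sub_pos.2 hq)
    simp only [D] at h5
    rw [hs] at h5
    rw [div_le_iff₀ (by positivity), ← pow_add]
    have e : m + 1 + l = m + (l + 1) := by ring
    rw [e] at h5
    linarith
end

section
/- The function f defined on (0, ∞) by f(x) = (1/x)·(1 + x)^{1 + 1/x} is strictly decreasing, and f(x) tends to 1 as x → ∞. -/
theorem stmt_19 :
    StrictAntiOn (fun x : ℝ => (1 + x) ^ (1 + 1 / x) / x) (Set.Ioi (0 : ℝ)) ∧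
    Filter.Tendsto (fun x : ℝ => (1 + x) ^ (1 + 1 / x) / x) Filter.atTop (nhds 1) := by
  constructor
  · have hd : ∀ x : ℝ, 0 < x → HasDerivAt
        (fun x : ℝ => Real.log (1 + x) * (1 + x⁻¹) - Real.log x)
        (-(Real.log (1 + x) / x ^ 2)) x := by
      intro x hx
      have h1 : HasDerivAt (fun x : ℝ => 1 + x) 1 x := (hasDerivAt_id x).const_add 1
      have h2 := h1.log (by positivity)
      have h3 := (hasDerivAt_inv hx.ne').const_add 1
      have h4 := (h2.mul h3).sub (Real.hasDerivAt_log hx.ne')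
      refine h4.congr_deriv ?_
      have : (1 + x) ≠ 0 := by positivity
      field_simp
      ring
    have hg : StrictAntiOn (fun x : ℝ => Real.log (1 + x) * (1 + x⁻¹) - Real.log x)
        (Set.Ioi (0 : ℝ)) := by
      apply strictAntiOn_of_deriv_neg (convex_Ioi 0)
      · intro x hx
        exact (hd x hx).continuousAt.continuousWithinAt
      · intro x hx
        rw [interior_Ioi] at hx
        have hx' : 0 < x := hx
        rw [(hd x hx').deriv]
        have : 0 < Real.log (1 + x) := Real.log_pos (by linarith)
        have : 0 < Real.log (1 + x) / x ^ 2 := by positivity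
        linarith
    refine (Real.exp_strictMono.comp_strictAntiOn hg).congr ?_
    intro x hx
    have hx' : 0 < x := hx
    simp only [Function.comp]
    rw [Real.exp_sub, Real.exp_log hx', Real.rpow_def_of_pos (by positivity), one_div]
  · have h1 := (tendsto_rpow_div_mul_add 1 1 (-1) (by norm_num)).comp
      (Filter.tendsto_atTop_add_const_left Filter.atTop (1 : ℝ) Filter.tendsto_id)
    have h2 : Filter.Tendsto (fun x : ℝ => 1 + x⁻¹) Filter.atTop (nhds (1 + 0)) :=
      tendsto_inv_atTop_zero.const_add 1
    have h3 := h1.mul h2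
    rw [add_zero, mul_one] at h3
    refine h3.congr' ?_
    filter_upwards [Filter.eventually_gt_atTop 0] with x hx
    simp only [Function.comp, id]
    rw [Real.rpow_add (by positivity), Real.rpow_one,
      show (1 : ℝ) * (1 + x) + -1 = x by ring]
    field_simp
    ring
end
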